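/- Let f : [a,b] → X have the property S*HK on [a,b], let Z₁ = { t₁ ∈ [a₁,b₁] : the section f_{t₁} does not have the property S*HK on [a₂,b₂] }, Z₂ = { t₂ ∈ [a₂,b₂] : the section f_{t₂} does not have the property S*HK on [a₁,b₁] }, Z = (Z₁ × [a₂,b₂]) ∪ ([a₁,b₁] × Z₂), and f₀ = f·𝟙_{[a,b]∖Z}. Then the function g(t₁) = (HK)∫_{[a₂,b₂]} (f₀)_{t₁}, t₁ ∈ [a₁,b₁], is strongly Henstock–Kurzweil integrable on [a₁,b₁] and (HK)∫_{[a₁,b₁]} ((HK)∫_{[a₂,b₂]} (f₀)_{t₁}) = (HK)∫_{[a,b]} f. -/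

import Mathlib

open Set MeasureTheory

variable {E : Type*} [MeasureSpace E] [PseudoMetricSpace E] [Preorder E]
variable {X : Type*} [NormedAddCommGroup X] [NormedSpace ℝ X]

/-- The closed interval of a tagged item `(t, p, q)` is `[p, q]` (the tag is `t`). -/
def itemBox (x : E × E × E) : Set E := Set.Icc x.2.1 x.2.2

/-- `[p,q]` is a closed non-degenerate subinterval of `K`. -/
def IsSubinterval (K : Set E) (p q : E) : Prop :=
  Set.Icc p q ⊆ K ∧ (interior (Set.Icc p q)).Nonempty

/-- `P` is an `𝓜`-partition of `K`: a finite collection of tagged pairwise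
non-overlapping closed non-degenerate subintervals of `K` covering `K`, with tags in `K`. -/
def IsMPartition (K : Set E) (P : Finset (E × E × E)) : Prop :=
  (∀ x ∈ P, x.1 ∈ K ∧ IsSubinterval K x.2.1 x.2.2) ∧
  (∀ x ∈ P, ∀ y ∈ P, x ≠ y → interior (itemBox x) ∩ interior (itemBox y) = ∅) ∧
  (⋃ x ∈ P, itemBox x) = K

/-- `𝓗𝓚`-partition: an `𝓜`-partition each of whose tags belongs to its interval. -/
def IsHKPartition (K : Set E) (P : Finset (E × E × E)) : Prop :=
  IsMPartition K P ∧ ∀ x ∈ P, x.1 ∈ itemBox x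

/-- A gauge on `K`: positive on `K`. -/
def IsGauge (K : Set E) (δ : E → ℝ) : Prop := ∀ t ∈ K, 0 < δ t

/-- A tagged partition is `δ`-fine if each interval lies in the open ball
around its tag of radius `δ(tag)`. -/
def IsFine (δ : E → ℝ) (P : Finset (E × E × E)) : Prop :=
  ∀ x ∈ P, itemBox x ⊆ Metric.ball x.1 (δ x.1)

/-- `f` is McShane integrable on `K` with integral `v`. -/
def HasMcShaneIntegral (K : Set E) (f : E → X) (v : X) : Prop :=
  ∀ ε > 0, ∃ δ : E → ℝ, IsGauge K δ ∧
    ∀ P : Finset (E × E × E), IsMPartition K P → IsFine δ P →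
      ‖(∑ x ∈ P, (volume (itemBox x)).toReal • f x.1) - v‖ < ε

/-- `f` is Henstock–Kurzweil integrable on `K` with integral `v`. -/
def HasHKIntegral (K : Set E) (f : E → X) (v : X) : Prop :=
  ∀ ε > 0, ∃ δ : E → ℝ, IsGauge K δ ∧
    ∀ P : Finset (E × E × E), IsHKPartition K P → IsFine δ P →
      ‖(∑ x ∈ P, (volume (itemBox x)).toReal • f x.1) - v‖ < ε

/-- An additive interval function on the non-degenerate closed subintervals of `K`
(an interval is recorded by its pair of corners). -/
def IsAdditiveIntervalFun (K : Set E) (F : E × E → X) : Prop :=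
  ∀ p q r s u w : E, IsSubinterval K p q → IsSubinterval K r s → IsSubinterval K u w →
    interior (Set.Icc p q) ∩ interior (Set.Icc r s) = ∅ →
    Set.Icc p q ∪ Set.Icc r s = Set.Icc u w →
    F (u, w) = F (p, q) + F (r, s)

/-- `f` is strongly McShane integrable on `[a,b]` with `(M)∫_{[a,b]} f = v`. -/
def HasStrongMcShaneIntegral (a b : E) (f : E → X) (v : X) : Prop :=
  ∃ F : E × E → X, IsAdditiveIntervalFun (Set.Icc a b) F ∧ F (a, b) = v ∧
    ∀ ε > 0, ∃ δ : E → ℝ, IsGauge (Set.Icc a b) δ ∧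
      ∀ P : Finset (E × E × E), IsMPartition (Set.Icc a b) P → IsFine δ P →
        ∑ x ∈ P, ‖(volume (itemBox x)).toReal • f x.1 - F (x.2.1, x.2.2)‖ < ε

/-- `f` is strongly Henstock–Kurzweil integrable on `[a,b]` with `(HK)∫_{[a,b]} f = v`. -/
def HasStrongHKIntegral (a b : E) (f : E → X) (v : X) : Prop :=
  ∃ F : E × E → X, IsAdditiveIntervalFun (Set.Icc a b) F ∧ F (a, b) = v ∧
    ∀ ε > 0, ∃ δ : E → ℝ, IsGauge (Set.Icc a b) δ ∧
      ∀ P : Finset (E × E × E), IsHKPartition (Set.Icc a b) P → IsFine δ P →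
        ∑ x ∈ P, ‖(volume (itemBox x)).toReal • f x.1 - F (x.2.1, x.2.2)‖ < ε

/-- Property `𝓢*𝓜` on `[a,b]`. -/
def PropSM (a b : E) (f : E → X) : Prop :=
  ∀ ε > 0, ∃ δ : E → ℝ, IsGauge (Set.Icc a b) δ ∧
    ∀ P Q : Finset (E × E × E),
      IsMPartition (Set.Icc a b) P → IsFine δ P →
      IsMPartition (Set.Icc a b) Q → IsFine δ Q →
      ∑ x ∈ P, ∑ y ∈ Q, ‖f x.1 - f y.1‖ * (volume (itemBox x ∩ itemBox y)).toReal < ε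

/-- Property `𝓢*𝓗𝓚` on `[a,b]`. -/
def PropSHK (a b : E) (f : E → X) : Prop :=
  ∀ ε > 0, ∃ δ : E → ℝ, IsGauge (Set.Icc a b) δ ∧
    ∀ P Q : Finset (E × E × E),
      IsHKPartition (Set.Icc a b) P → IsFine δ P →
      IsHKPartition (Set.Icc a b) Q → IsFine δ Q →
      ∑ x ∈ P, ∑ y ∈ Q, ‖f x.1 - f y.1‖ * (volume (itemBox x ∩ itemBox y)).toReal < ε


set_option linter.unusedSectionVars false

/-- An induction principle for subintervals: a property of subintervals of `[a, b]` that passes to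
unions of two non-overlapping subintervals and holds for all small subintervals around each point
holds for `[a, b]`. -/
def SubintervalInduction (a b : E) : Prop :=
  ∀ p : E → E → Prop,
    (∀ q r s t u w, IsSubinterval (Icc a b) q r → IsSubinterval (Icc a b) s t →
      IsSubinterval (Icc a b) u w → interior (Icc q r) ∩ interior (Icc s t) = ∅ →
      Icc q r ∪ Icc s t = Icc u w → p q r → p s t → p u w) →
    (∀ t ∈ Icc a b, ∃ δ > 0, ∀ u w, IsSubinterval (Icc a b) u w → t ∈ Icc u w →
      Icc u w ⊆ Metric.ball t δ → p u w) →
    p a b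

lemma isSubinterval_real_iff {a b p q : ℝ} :
    IsSubinterval (Icc a b) p q ↔ a ≤ p ∧ p < q ∧ q ≤ b := by
  unfold IsSubinterval
  rw [interior_Icc, nonempty_Ioo]
  constructor
  · rintro ⟨h, hpq⟩
    rw [Icc_subset_Icc_iff hpq.le] at h
    exact ⟨h.1, hpq, h.2⟩
  · rintro ⟨h1, h2, h3⟩
    exact ⟨Icc_subset_Icc h1 h3, h2⟩

lemma real_interval_induction {a b : ℝ} (hab : a < b) (p : ℝ → ℝ → Prop)
    (glue : ∀ x y z, a ≤ x → x < y → y < z → z ≤ b → p x y → p y z → p x z)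
    (loc : ∀ t ∈ Icc a b, ∃ δ > 0, ∀ u w, a ≤ u → u < w → w ≤ b → t ∈ Icc u w →
      Icc u w ⊆ Metric.ball t δ → p u w) : p a b := by
  have key : Icc a b ⊆ {x | ∀ y, a < y → y ≤ x → y ≤ b → p a y} := by
    apply IsClosed.Icc_subset_of_forall_exists_gt
    · refine isClosed_of_closure_subset fun c hc => ?_
      have hcab : c ∈ Icc a b := by
        have := closure_mono (inter_subset_right) hc
        rwa [isClosed_Icc.closure_eq] at this
      refine ⟨?_, hcab⟩
      intro y hay hyc hyb
      obtain ⟨δ, hδ, hp⟩ := loc c hcab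
      rw [Metric.mem_closure_iff] at hc
      rcases hyc.lt_or_eq with hlt | rfl
      · obtain ⟨x, ⟨hx, -⟩, hxc⟩ := hc (c - y) (by linarith)
        rw [Real.dist_eq, abs_lt] at hxc
        exact hx y hay (by linarith) hyb
      · obtain ⟨x, ⟨hx, hxab⟩, hxc⟩ := hc δ hδ
        rw [Real.dist_eq, abs_lt] at hxc
        rcases le_or_gt y x with h | h
        · exact hx y hay h hyb
        · have hxy : p x y := by
            refine hp x y hxab.1 h hyb ⟨h.le, le_rfl⟩ fun s hs => ?_
            rw [Metric.mem_ball, Real.dist_eq, abs_lt]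
            constructor <;> linarith [hs.1, hs.2]
          rcases hxab.1.lt_or_eq with hax | rfl
          · exact glue a x y le_rfl hax h hyb (hx x hax le_rfl hxab.2) hxy
          · exact hxy
    · intro y hay hya
      exact absurd hay (not_lt.2 hya)
    · rintro x ⟨hx, hxa, hxb⟩ y hy
      obtain ⟨δ, hδ, hp⟩ := loc x ⟨hxa, hxb.le⟩
      refine ⟨min y (x + δ / 2), ?_, lt_min hy (by linarith), min_le_left _ _⟩
      intro z haz hz hzb
      rcases le_or_gt z x with h | h
      · exact hx z haz h hzb
      · have hz' := hz.trans (min_le_right _ _)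
        have hxz : p x z := by
          refine hp x z hxa h hzb ⟨le_rfl, h.le⟩ fun s hs => ?_
          rw [Metric.mem_ball, Real.dist_eq, abs_lt]
          constructor <;> linarith [hs.1, hs.2]
        rcases hxa.lt_or_eq with hax | rfl
        · exact glue a x z le_rfl hax h hzb (hx x hax le_rfl hxb.le) hxz
        · exact hxz
  exact key ⟨hab.le, le_rfl⟩ b hab le_rfl le_rfl

lemma subintervalInduction_real {a b : ℝ} (hab : a < b) : SubintervalInduction a b := by
  intro p glue loc
  refine real_interval_induction hab p (fun x y z hax hxy hyz hzb => ?_) fun t ht => ?_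
  · apply glue x y y z x z <;> try rw [isSubinterval_real_iff]
    · exact ⟨hax, hxy, by linarith⟩
    · exact ⟨by linarith, hyz, hzb⟩
    · exact ⟨hax, hxy.trans hyz, hzb⟩
    · rw [interior_Icc, interior_Icc, ← Set.disjoint_iff_inter_eq_empty, Ioo_disjoint_Ioo]
      simp [hxy.le, hyz.le]
    · exact Icc_union_Icc_eq_Icc hxy.le hyz.le
  · obtain ⟨δ, hδ, h⟩ := loc t ht
    exact ⟨δ, hδ, fun u w hu huw hw => h u w (isSubinterval_real_iff.2 ⟨hu, huw, hw⟩)⟩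

lemma isSubinterval_real_prod {a₁ b₁ a₂ b₂ u w p q : ℝ} (h₁ : a₁ ≤ u ∧ u < w ∧ w ≤ b₁)
    (h₂ : a₂ ≤ p ∧ p < q ∧ q ≤ b₂) :
    IsSubinterval (Icc ((a₁, a₂) : ℝ × ℝ) (b₁, b₂)) (u, p) (w, q) := by
  constructor
  · exact Icc_subset_Icc ⟨h₁.1, h₂.1⟩ ⟨h₁.2.2, h₂.2.2⟩
  · rw [Icc_prod_eq, interior_prod_eq, interior_Icc, interior_Icc]
    exact (nonempty_Ioo.2 h₁.2.1).prod (nonempty_Ioo.2 h₂.2.1)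

lemma subintervalInduction_real_prod {a₁ b₁ a₂ b₂ : ℝ} (hab₁ : a₁ < b₁) (hab₂ : a₂ < b₂) :
    SubintervalInduction ((a₁, a₂) : ℝ × ℝ) (b₁, b₂) := by
  intro p glue loc
  have hdisj : ∀ {x y z : ℝ}, x < y → y < z → Ioo x y ∩ Ioo y z = ∅ := by
    intro x y z hxy hyz
    rw [← Set.disjoint_iff_inter_eq_empty, Ioo_disjoint_Ioo]
    simp [hxy.le, hyz.le]
  refine real_interval_induction hab₁ (fun u w => p (u, a₂) (w, b₂))
    (fun x y z hax hxy hyz hzb => ?_) fun t ht => ?_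
  · apply glue (x, a₂) (y, b₂) (y, a₂) (z, b₂) (x, a₂) (z, b₂)
    · exact isSubinterval_real_prod ⟨hax, hxy, by linarith⟩ ⟨le_rfl, hab₂, le_rfl⟩
    · exact isSubinterval_real_prod ⟨by linarith, hyz, hzb⟩ ⟨le_rfl, hab₂, le_rfl⟩
    · exact isSubinterval_real_prod ⟨hax, hxy.trans hyz, hzb⟩ ⟨le_rfl, hab₂, le_rfl⟩
    · simp only [Icc_prod_eq, interior_prod_eq, interior_Icc, prod_inter_prod, hdisj hxy hyz,
        empty_prod]
    · simp only [Icc_prod_eq]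
      rw [← union_prod, Icc_union_Icc_eq_Icc hxy.le hyz.le]
  · have := real_interval_induction hab₂ (fun c d => ∃ δ > 0, ∀ u w, a₁ ≤ u → u < w → w ≤ b₁ →
      t ∈ Icc u w → Icc u w ⊆ Metric.ball t δ → p (u, c) (w, d)) ?_ ?_
    · exact this
    · rintro x y z hax hxy hyz hzb ⟨δ, hδ, h⟩ ⟨δ', hδ', h'⟩
      refine ⟨min δ δ', lt_min hδ hδ', fun u w hu huw hw htu hball => ?_⟩
      apply glue (u, x) (w, y) (u, y) (w, z) (u, x) (w, z)
      · exact isSubinterval_real_prod ⟨hu, huw, hw⟩ ⟨hax, hxy, by linarith⟩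
      · exact isSubinterval_real_prod ⟨hu, huw, hw⟩ ⟨by linarith, hyz, hzb⟩
      · exact isSubinterval_real_prod ⟨hu, huw, hw⟩ ⟨hax, hxy.trans hyz, hzb⟩
      · simp only [Icc_prod_eq, interior_prod_eq, interior_Icc, prod_inter_prod, hdisj hxy hyz,
          prod_empty]
      · simp only [Icc_prod_eq]
        rw [← prod_union, Icc_union_Icc_eq_Icc hxy.le hyz.le]
      · exact h u w hu huw hw htu (hball.trans (Metric.ball_subset_ball (min_le_left _ _)))
      · exact h' u w hu huw hw htu (hball.trans (Metric.ball_subset_ball (min_le_right _ _)))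
    · intro s hs
      obtain ⟨δ, hδ, h⟩ := loc (t, s) (by rw [Icc_prod_eq]; exact ⟨ht, hs⟩)
      refine ⟨δ, hδ, fun c d hc hcd hd hsc hball => ⟨δ, hδ, fun u w hu huw hw htu hball' => ?_⟩⟩
      refine h _ _ (isSubinterval_real_prod ⟨hu, huw, hw⟩ ⟨hc, hcd, hd⟩) ?_ ?_
      · rw [Icc_prod_eq]
        exact ⟨htu, hsc⟩
      · rw [Icc_prod_eq, ← ball_prod_same]
        exact prod_mono hball' hball

/-- Cousin's lemma, with tags taken from `A` in every interval that meets `A`. -/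
lemma exists_fine_partition {a b : E} (hI : SubintervalInduction a b) {δ : E → ℝ}
    (hδ : IsGauge (Icc a b) δ) (A : Set E) {r : ℝ} (hr : 0 < r) (hA : ∀ t ∈ A, r ≤ δ t) :
    ∃ P : Finset (E × E × E), IsHKPartition (Icc a b) P ∧ IsFine δ P ∧
      ∀ x ∈ P, x.1 ∈ A ∨ Disjoint (itemBox x) A := by
  classical
  refine hI (fun u w => ∃ P : Finset (E × E × E), IsHKPartition (Icc u w) P ∧ IsFine δ P ∧
      ∀ x ∈ P, x.1 ∈ A ∨ Disjoint (itemBox x) A) ?_ ?_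
  · rintro q r s t u w - - - hdisj hun ⟨P, ⟨⟨hP1, hP2, hP3⟩, hP4⟩, hPf, hPA⟩
      ⟨Q, ⟨⟨hQ1, hQ2, hQ3⟩, hQ4⟩, hQf, hQA⟩
    have hcross : ∀ x ∈ P, ∀ y ∈ Q, interior (itemBox x) ∩ interior (itemBox y) = ∅ := by
      intro x hx y hy
      rw [← subset_empty_iff, ← hdisj]
      exact inter_subset_inter (interior_mono (hP1 x hx).2.1) (interior_mono (hQ1 y hy).2.1)
    have hl : Icc q r ⊆ Icc u w := hun ▸ subset_union_left
    have hr : Icc s t ⊆ Icc u w := hun ▸ subset_union_right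
    refine ⟨P ∪ Q, ⟨⟨?_, ?_, ?_⟩, ?_⟩, ?_, ?_⟩
    · intro x hx
      rcases Finset.mem_union.1 hx with h | h
      · exact ⟨hl (hP1 x h).1, (hP1 x h).2.1.trans hl, (hP1 x h).2.2⟩
      · exact ⟨hr (hQ1 x h).1, (hQ1 x h).2.1.trans hr, (hQ1 x h).2.2⟩
    · intro x hx y hy hxy
      rcases Finset.mem_union.1 hx with h | h <;> rcases Finset.mem_union.1 hy with h' | h'
      · exact hP2 x h y h' hxy
      · exact hcross x h y h'
      · rw [inter_comm]; exact hcross y h' x h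
      · exact hQ2 x h y h' hxy
    · rw [← hun, ← hP3, ← hQ3, Finset.set_biUnion_union]
    all_goals
      intro x hx
      rcases Finset.mem_union.1 hx with h | h
    · exact hP4 x h
    · exact hQ4 x h
    · exact hPf x h
    · exact hQf x h
    · exact hPA x h
    · exact hQA x h
  · intro t ht
    refine ⟨min (δ t) (r / 2), lt_min (hδ t ht) (by linarith), fun u w huw htu hball => ?_⟩
    have hsingle : ∀ s ∈ Icc u w, Icc u w ⊆ Metric.ball s (δ s) →
        (s ∈ A ∨ Disjoint (Icc u w) A) → ∃ P : Finset (E × E × E), IsHKPartition (Icc u w) P ∧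
          IsFine δ P ∧ ∀ x ∈ P, x.1 ∈ A ∨ Disjoint (itemBox x) A := by
      intro s hs hsb hsA
      refine ⟨{(s, u, w)}, ⟨⟨?_, ?_, ?_⟩, ?_⟩, ?_, ?_⟩
      · simpa using ⟨hs, subset_rfl, huw.2⟩
      · simp
      · simp [itemBox]
      · simpa [itemBox] using hs
      · simpa [IsFine, itemBox] using hsb
      · simpa [itemBox] using hsA
    by_cases hmeet : Disjoint (Icc u w) A
    · exact hsingle t htu (hball.trans (Metric.ball_subset_ball (min_le_left _ _))) (Or.inr hmeet)
    · obtain ⟨s, hs, hsA⟩ := not_disjoint_iff.1 hmeet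
      refine hsingle s hs (fun y hy => ?_) (Or.inl hsA)
      have h1 := Metric.mem_ball.1 (hball hy)
      have h2 := Metric.mem_ball'.1 (hball hs)
      have h3 := min_le_right (δ t) (r / 2)
      have h4 := hA s hsA
      have h5 := dist_triangle y t s
      rw [Metric.mem_ball]
      linarith

section Boxes

variable [BorelSpace E] [OrderClosedTopology E]

lemma aedisjoint_Icc (hfr : ∀ p q : E, volume (frontier (Icc p q)) = 0) {p q r s : E}
    (h : interior (Icc p q) ∩ interior (Icc r s) = ∅) :
    AEDisjoint volume (Icc p q) (Icc r s) :=
  (Set.disjoint_iff_inter_eq_empty.2 h).aedisjoint.congr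
    (interior_ae_eq_of_null_frontier (hfr p q)).symm (interior_ae_eq_of_null_frontier (hfr r s)).symm

lemma measurableSet_itemBox (x : E × E × E) : MeasurableSet (itemBox x) := measurableSet_Icc

lemma IsMPartition.itemBox_subset {K : Set E} {P : Finset (E × E × E)} (hP : IsMPartition K P)
    {x : E × E × E} (hx : x ∈ P) : itemBox x ⊆ K := (hP.1 x hx).2.1

lemma setLIntegral_eq_sum_itemBox (hfr : ∀ p q : E, volume (frontier (Icc p q)) = 0) {K : Set E}
    {P : Finset (E × E × E)} (hP : IsMPartition K P) {B : Set E} (hB : MeasurableSet B)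
    (hBK : B ⊆ K) (h : E → ENNReal) :
    ∫⁻ s in B, h s = ∑ x ∈ P, ∫⁻ s in B ∩ itemBox x, h s := by
  rw [← lintegral_biUnion_finset₀]
  · rw [← inter_iUnion₂, hP.2.2, inter_eq_left.2 hBK]
  · intro x hx y hy hxy
    exact (aedisjoint_Icc hfr (hP.2.1 x hx y hy hxy)).mono inter_subset_right inter_subset_right
  · exact fun x _ => (hB.inter (measurableSet_itemBox x)).nullMeasurableSet

lemma sum_setLIntegral_itemBox (hfr : ∀ p q : E, volume (frontier (Icc p q)) = 0) {a b : E}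
    {P : Finset (E × E × E)} (hP : IsMPartition (Icc a b) P) (h : E → ENNReal) :
    ∑ x ∈ P, ∫⁻ s in itemBox x, h s = ∫⁻ s in Icc a b, h s := by
  rw [setLIntegral_eq_sum_itemBox hfr hP measurableSet_Icc subset_rfl]
  exact Finset.sum_congr rfl fun x hx => by rw [inter_eq_right.2 (hP.itemBox_subset hx)]

lemma sum_volume_itemBox (hfr : ∀ p q : E, volume (frontier (Icc p q)) = 0) {a b : E}
    {P : Finset (E × E × E)} (hP : IsMPartition (Icc a b) P) :
    ∑ x ∈ P, volume (itemBox x) = volume (Icc a b) := by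
  simpa using sum_setLIntegral_itemBox hfr hP (fun _ => 1)

/-- The step function of a tagged partition. -/
noncomputable def stepFun (P : Finset (E × E × E)) (f : E → X) (s : E) : X :=
  ∑ x ∈ P, (interior (itemBox x)).indicator (fun _ => f x.1) s

lemma stepFun_ae_eq (hfr : ∀ p q : E, volume (frontier (Icc p q)) = 0) {K : Set E}
    {P : Finset (E × E × E)} (hP : IsMPartition K P) (f : E → X) {x : E × E × E} (hx : x ∈ P) :
    ∀ᵐ s ∂volume.restrict (itemBox x), stepFun P f s = f x.1 := by
  have hae : interior (itemBox x) =ᵐ[volume] itemBox x :=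
    interior_ae_eq_of_null_frontier (hfr x.2.1 x.2.2)
  rw [← Measure.restrict_congr_set hae]
  filter_upwards [ae_restrict_mem isOpen_interior.measurableSet] with s hs
  unfold stepFun
  rw [Finset.sum_eq_single x]
  · exact indicator_of_mem hs _
  · intro y hy hyx
    refine indicator_of_notMem (fun hys => ?_) _
    have : s ∈ interior (itemBox y) ∩ interior (itemBox x) := ⟨hys, hs⟩
    rw [hP.2.1 y hy x hx hyx] at this
    exact this
  · exact fun h => absurd hx h

lemma setLIntegral_edist_stepFun (hfr : ∀ p q : E, volume (frontier (Icc p q)) = 0) {K : Set E}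
    {P : Finset (E × E × E)} (hP : IsMPartition K P) {B : Set E} (hB : MeasurableSet B)
    (hBK : B ⊆ K) (f h : E → X) :
    ∫⁻ s in B, edist (stepFun P f s) (h s) =
      ∑ x ∈ P, ∫⁻ s in B ∩ itemBox x, edist (f x.1) (h s) := by
  rw [setLIntegral_eq_sum_itemBox hfr hP hB hBK]
  refine Finset.sum_congr rfl fun x hx => lintegral_congr_ae ?_
  have := ae_mono (Measure.restrict_mono_set volume (inter_subset_right (s := B)))
    (stepFun_ae_eq hfr hP f hx)
  filter_upwards [this] with s hs
  rw [hs]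

lemma sum_setLIntegral_edist_eq_stepFun (hfr : ∀ p q : E, volume (frontier (Icc p q)) = 0)
    {a b : E} {P : Finset (E × E × E)} (hP : IsMPartition (Icc a b) P) (f h : E → X) :
    ∑ x ∈ P, ∫⁻ s in itemBox x, edist (f x.1) (h s) =
      ∫⁻ s in Icc a b, edist (stepFun P f s) (h s) := by
  rw [setLIntegral_edist_stepFun hfr hP measurableSet_Icc subset_rfl]
  exact Finset.sum_congr rfl fun x hx => by rw [inter_eq_right.2 (hP.itemBox_subset hx)]

lemma lintegral_edist_stepFun_stepFun (hfr : ∀ p q : E, volume (frontier (Icc p q)) = 0)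
    {a b : E} {P Q : Finset (E × E × E)} (hP : IsMPartition (Icc a b) P)
    (hQ : IsMPartition (Icc a b) Q) (f : E → X) :
    ∫⁻ s in Icc a b, edist (stepFun P f s) (stepFun Q f s) =
      ∑ x ∈ P, ∑ y ∈ Q, edist (f x.1) (f y.1) * volume (itemBox x ∩ itemBox y) := by
  rw [← sum_setLIntegral_edist_eq_stepFun hfr hP]
  refine Finset.sum_congr rfl fun x hx => ?_
  simp_rw [edist_comm (f x.1)]
  rw [setLIntegral_edist_stepFun hfr hQ (measurableSet_itemBox x) (hP.itemBox_subset hx) f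
    (fun _ => f x.1)]
  exact Finset.sum_congr rfl fun y hy => by rw [setLIntegral_const, edist_comm]

variable [CompactIccSpace E] [IsLocallyFiniteMeasure (volume : Measure E)]

lemma volume_itemBox_ne_top (x : E × E × E) : volume (itemBox x) ≠ ⊤ :=
  isCompact_Icc.measure_ne_top

lemma integrable_stepFun (a b : E) (P : Finset (E × E × E)) (f : E → X) :
    Integrable (stepFun P f) (volume.restrict (Icc a b)) := by
  have : IsFiniteMeasure (volume.restrict (Icc a b)) :=
    isFiniteMeasure_restrict.2 isCompact_Icc.measure_ne_top
  exact integrable_finsetSum _ fun x _ =>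
    (integrable_const (f x.1)).indicator isOpen_interior.measurableSet

lemma ofReal_sum_norm_sub_mul_volume (P Q : Finset (E × E × E)) (f : E → X) :
    ENNReal.ofReal (∑ x ∈ P, ∑ y ∈ Q,
      ‖f x.1 - f y.1‖ * (volume (itemBox x ∩ itemBox y)).toReal) =
      ∑ x ∈ P, ∑ y ∈ Q, edist (f x.1) (f y.1) * volume (itemBox x ∩ itemBox y) := by
  rw [ENNReal.ofReal_sum_of_nonneg fun x _ => Finset.sum_nonneg fun y _ => by positivity]
  refine Finset.sum_congr rfl fun x _ => ?_
  rw [ENNReal.ofReal_sum_of_nonneg fun y _ => by positivity]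
  refine Finset.sum_congr rfl fun y _ => ?_
  rw [ENNReal.ofReal_mul (norm_nonneg _), ENNReal.ofReal_toReal
    (measure_ne_top_of_subset inter_subset_left (volume_itemBox_ne_top x)), ← dist_eq_norm,
    ← edist_dist]

/-- A Bochner integrable function oscillates little, in the mean, around its values at the tags
of a fine partition. -/
lemma exists_gauge_sum_setLIntegral_edist_le
    (hfr : ∀ p q : E, volume (frontier (Icc p q)) = 0) {a b : E} {f : E → X}
    (hf : IntegrableOn f (Icc a b)) {ε : ENNReal} (hε : ε ≠ 0) :
    ∃ δ : E → ℝ, IsGauge (Icc a b) δ ∧ ∀ P : Finset (E × E × E), IsMPartition (Icc a b) P →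
      IsFine δ P → ∑ x ∈ P, ∫⁻ s in itemBox x, edist (f x.1) (f s) ≤ ε := by
  have : IsFiniteMeasure (volume.restrict (Icc a b)) :=
    isFiniteMeasure_restrict.2 isCompact_Icc.measure_ne_top
  have hε4 : ε / 4 ≠ 0 := by simpa using hε
  obtain ⟨g, hg, hgi⟩ :=
    (memLp_one_iff_integrable.2 hf).exists_boundedContinuous_eLpNorm_sub_le (by simp) hε4
  rw [memLp_one_iff_integrable] at hgi
  simp only [eLpNorm_one_eq_lintegral_enorm, Pi.sub_apply] at hg
  obtain ⟨H, hfH, hH, hHint⟩ := exists_lt_lowerSemicontinuous_lintegral_ge_of_aemeasurable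
    (volume.restrict (Icc a b)) (fun s => ‖f s - g s‖₊)
    (hf.sub hgi).aestronglyMeasurable.nnnorm.aemeasurable hε4
  obtain ⟨η, hη, hηε⟩ := ENNReal.exists_nnreal_pos_mul_lt
    ((isCompact_Icc (a := a) (b := b)).measure_ne_top (μ := volume)) hε4
  have hloc : ∀ t : E, ∃ δ > 0, ∀ s ∈ Metric.ball t δ,
      (‖f t - g t‖₊ : ENNReal) < H s ∧ edist (g t) (g s) ≤ η := by
    intro t
    have h1 := hH t _ (hfH t)
    have h2 : ∀ᶠ s in nhds t, edist (g s) (g t) < η :=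
      EMetric.tendsto_nhds.1 g.continuous.continuousAt η (by simpa using hη)
    obtain ⟨δ, hδ, h⟩ := Metric.eventually_nhds_iff_ball.1 (h1.and h2)
    exact ⟨δ, hδ, fun s hs => ⟨(h s hs).1, by rw [edist_comm]; exact (h s hs).2.le⟩⟩
  choose δ hδ hball using hloc
  refine ⟨δ, fun t _ => hδ t, fun P hP hfine => ?_⟩
  have hpt : ∀ x ∈ P, ∫⁻ s in itemBox x, edist (f x.1) (f s) ≤
      ∫⁻ s in itemBox x, H s + η + ‖f s - g s‖ₑ := by
    intro x hx
    refine setLIntegral_mono' (measurableSet_itemBox x) fun s hs => ?_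
    obtain ⟨h1, h2⟩ := hball x.1 s (hfine x hx hs)
    calc edist (f x.1) (f s) ≤ edist (f x.1) (g x.1) + edist (g x.1) (g s) + edist (g s) (f s) :=
          edist_triangle4 _ _ _ _
      _ ≤ H s + η + ‖f s - g s‖ₑ := by
          gcongr
          · rw [edist_eq_enorm_sub]; exact h1.le
          · rw [edist_comm, edist_eq_enorm_sub]
  refine (Finset.sum_le_sum hpt).trans ?_
  have hHη : Measurable fun s => H s + (η : ENNReal) := hH.measurable.add_const _
  rw [sum_setLIntegral_itemBox hfr hP, lintegral_add_left hHη,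
    lintegral_add_left hH.measurable, setLIntegral_const]
  calc _ ≤ (ε / 4 + ε / 4) + ε / 4 + ε / 4 := by
        gcongr
        exact hHint.trans (by gcongr; exact hg)
    _ = ε := by
        have : ε / 4 + ε / 4 = ε / 2 := by
          rw [← two_mul, ← mul_div_assoc, show (4 : ENNReal) = 2 * 2 by norm_num]
          exact ENNReal.mul_div_mul_left _ _ (by simp) (by simp)
        rw [add_assoc (ε / 4 + ε / 4), this, ENNReal.add_halves]

/-- A nonnegative function with vanishing Henstock–Kurzweil sums vanishes almost everywhere. -/
lemma ae_eq_zero_of_sum_le {a b : E} (hI : SubintervalInduction a b) {h : E → ENNReal}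
    (hh : ∀ ε : ENNReal, ε ≠ 0 → ∃ δ : E → ℝ, IsGauge (Icc a b) δ ∧
      ∀ P : Finset (E × E × E), IsHKPartition (Icc a b) P → IsFine δ P →
        ∑ x ∈ P, h x.1 * volume (itemBox x) ≤ ε) :
    ∀ᵐ s ∂volume.restrict (Icc a b), h s = 0 := by
  classical
  have hlevel : ∀ c : ENNReal, c ≠ 0 → volume {s ∈ Icc a b | c < h s} = 0 := by
    intro c hc
    suffices hm : c * volume {s ∈ Icc a b | c < h s} = 0 from
      (mul_eq_zero.1 hm).resolve_left hc
    by_contra hne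
    obtain ⟨ε, hε, hεlt⟩ := exists_between (pos_iff_ne_zero.2 hne)
    obtain ⟨δ, hδ, hsum⟩ := hh ε hε.ne'
    refine hεlt.not_ge ?_
    have hun : {s ∈ Icc a b | c < h s} =
        ⋃ m : ℕ, {s ∈ Icc a b | c < h s ∧ 1 / ((m : ℝ) + 1) ≤ δ s} := by
      ext s
      simp only [mem_ofPred_eq, mem_iUnion]
      constructor
      · rintro ⟨hs, hcs⟩
        obtain ⟨m, hm⟩ := exists_nat_one_div_lt (hδ s hs)
        exact ⟨m, hs, hcs, hm.le⟩
      · rintro ⟨m, hs, hcs, -⟩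
        exact ⟨hs, hcs⟩
    have hmono : Monotone fun m : ℕ => {s ∈ Icc a b | c < h s ∧ 1 / ((m : ℝ) + 1) ≤ δ s} := by
      rintro m n hmn s ⟨hs, hcs, hm⟩
      exact ⟨hs, hcs, (Nat.one_div_le_one_div hmn).trans hm⟩
    rw [hun, hmono.measure_iUnion, ENNReal.mul_iSup]
    refine iSup_le fun m => ?_
    set A := {s ∈ Icc a b | c < h s ∧ 1 / ((m : ℝ) + 1) ≤ δ s} with hA
    obtain ⟨P, hP, hfine, hPA⟩ := exists_fine_partition hI hδ A (r := 1 / ((m : ℝ) + 1))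
      (by positivity) fun t ht => ht.2.2
    have hcover : A ⊆ ⋃ x ∈ P.filter (fun x => x.1 ∈ A), itemBox x := by
      intro s hs
      have hsK : s ∈ ⋃ x ∈ P, itemBox x := by rw [hP.1.2.2]; exact hs.1
      obtain ⟨x, hx, hsx⟩ := mem_iUnion₂.1 hsK
      refine mem_iUnion₂.2 ⟨x, Finset.mem_filter.2 ⟨hx, ?_⟩, hsx⟩
      exact (hPA x hx).resolve_right fun hd => Set.disjoint_left.1 hd hsx hs
    calc c * volume A ≤ c * ∑ x ∈ P.filter (fun x => x.1 ∈ A), volume (itemBox x) := by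
          gcongr
          exact (measure_mono hcover).trans (measure_biUnion_finset_le _ _)
      _ = ∑ x ∈ P.filter (fun x => x.1 ∈ A), c * volume (itemBox x) := Finset.mul_sum _ _ _
      _ ≤ ∑ x ∈ P.filter (fun x => x.1 ∈ A), h x.1 * volume (itemBox x) := by
          refine Finset.sum_le_sum fun x hx => ?_
          gcongr
          exact (Finset.mem_filter.1 hx).2.2.1.le
      _ ≤ ∑ x ∈ P, h x.1 * volume (itemBox x) :=
          Finset.sum_le_sum_of_subset (Finset.filter_subset _ _)
      _ ≤ ε := hsum P hP hfine
  rw [ae_restrict_iff' measurableSet_Icc, ae_iff]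
  refine measure_mono_null (fun s hs => ?_)
    (measure_iUnion_null fun n : ℕ => hlevel ((n : ENNReal)⁻¹) (by simp))
  simp only [mem_ofPred_eq, Classical.not_imp] at hs
  obtain ⟨n, hn⟩ := ENNReal.exists_inv_nat_lt hs.2
  exact mem_iUnion.2 ⟨n, hs.1, hn⟩

lemma IsFine.mono {δ δ' : E → ℝ} {P : Finset (E × E × E)} (h : IsFine δ P)
    (hδ : ∀ t, δ t ≤ δ' t) : IsFine δ' P :=
  fun x hx => (h x hx).trans (Metric.ball_subset_ball (hδ x.1))

lemma PropSHK.integrableOn [CompleteSpace X] (hfr : ∀ p q : E, volume (frontier (Icc p q)) = 0)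
    {a b : E} (hI : SubintervalInduction a b) {f : E → X} (hf : PropSHK a b f) :
    IntegrableOn f (Icc a b) := by
  choose δ hδ hsum using fun n : ℕ => hf ((1 / 2 : ℝ) ^ n) (by positivity)
  have hedist : ∀ n P Q, IsHKPartition (Icc a b) P → IsFine (δ n) P →
      IsHKPartition (Icc a b) Q → IsFine (δ n) Q →
      edist ((integrable_stepFun a b P f).toL1 _) ((integrable_stepFun a b Q f).toL1 _) ≤
        ENNReal.ofReal ((1 / 2 : ℝ) ^ n) := by
    intro n P Q hP hPf hQ hQf
    rw [Integrable.edist_toL1_toL1, lintegral_edist_stepFun_stepFun hfr hP.1 hQ.1,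
      ← ofReal_sum_norm_sub_mul_volume]
    exact ENNReal.ofReal_le_ofReal (hsum n P Q hP hPf hQ hQf).le
  have hpart : ∀ n : ℕ, ∃ P, IsHKPartition (Icc a b) P ∧ ∀ k ≤ n, IsFine (δ k) P := by
    intro n
    have hgauge : IsGauge (Icc a b)
        fun t => (Finset.range (n + 1)).inf' Finset.nonempty_range_add_one fun k => δ k t :=
      fun t ht => (Finset.lt_inf'_iff _).2 fun k _ => hδ k t ht
    obtain ⟨P, hP, hPf, -⟩ := exists_fine_partition hI hgauge ∅ one_pos (by simp)
    exact ⟨P, hP, fun k hk => hPf.mono fun t =>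
      Finset.inf'_le _ (Finset.mem_range.2 (Nat.lt_succ_of_le hk))⟩
  choose P hP hPf using hpart
  have htend : Filter.Tendsto (fun n : ℕ => (1 / 2 : ℝ) ^ n) Filter.atTop (nhds 0) :=
    tendsto_pow_atTop_nhds_zero_of_lt_one (by norm_num) (by norm_num)
  have hcauchy : CauchySeq fun n => (integrable_stepFun a b (P n) f).toL1 _ := by
    refine cauchySeq_of_le_tendsto_0' _ (fun n m hnm => ?_) htend
    rw [← edist_le_ofReal (by positivity)]
    exact hedist n _ _ (hP n) (hPf n n le_rfl) (hP m) (hPf m n hnm)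
  obtain ⟨φ, hφ⟩ := cauchySeq_tendsto_of_complete hcauchy
  have hφi : Integrable φ (volume.restrict (Icc a b)) := L1.integrable_coeFn φ
  have hφe : φ = hφi.toL1 _ := (Integrable.toL1_coeFn φ hφi).symm
  have hlim : ∀ n Q, IsHKPartition (Icc a b) Q → IsFine (δ n) Q →
      ∑ x ∈ Q, ∫⁻ s in itemBox x, edist (f x.1) (φ s) ≤ ENNReal.ofReal ((1 / 2 : ℝ) ^ n) := by
    intro n Q hQ hQf
    rw [sum_setLIntegral_edist_eq_stepFun hfr hQ.1,
      ← Integrable.edist_toL1_toL1 _ _ (integrable_stepFun a b Q f) hφi, ← hφe]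
    refine le_of_tendsto (tendsto_const_nhds.edist hφ) ?_
    filter_upwards [Filter.eventually_ge_atTop n] with m hm
    exact hedist n _ _ hQ hQf (hP m) (hPf m n hm)
  have hzero : ∀ᵐ s ∂volume.restrict (Icc a b), edist (f s) (φ s) = 0 := by
    refine ae_eq_zero_of_sum_le hI fun ε hε => ?_
    have hε2 : ε / 2 ≠ 0 := by simpa using hε
    obtain ⟨δ', hδ', hδ's⟩ := exists_gauge_sum_setLIntegral_edist_le hfr hφi hε2
    have htend' : Filter.Tendsto (fun n : ℕ => ENNReal.ofReal ((1 / 2 : ℝ) ^ n)) Filter.atTop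
        (nhds 0) := by
      simpa using ENNReal.tendsto_ofReal htend
    obtain ⟨n, hn⟩ := (htend'.eventually (gt_mem_nhds (pos_iff_ne_zero.2 hε2))).exists
    refine ⟨fun t => min (δ n t) (δ' t), fun t ht => lt_min (hδ n t ht) (hδ' t ht),
      fun Q hQ hQf => ?_⟩
    have hle : ∀ x ∈ Q, edist (f x.1) (φ x.1) * volume (itemBox x) ≤
        (∫⁻ s in itemBox x, edist (f x.1) (φ s)) + ∫⁻ s in itemBox x, edist (φ x.1) (φ s) := by
      intro x _
      rw [← setLIntegral_const, ← lintegral_add_left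
        (stronglyMeasurable_const.edist (Lp.stronglyMeasurable φ)).measurable]
      exact lintegral_mono fun s => edist_triangle_right _ _ _
    refine (Finset.sum_le_sum hle).trans ?_
    rw [Finset.sum_add_distrib, ← ENNReal.add_halves ε]
    gcongr
    · exact (hlim n Q hQ (hQf.mono fun t => min_le_left _ _)).trans hn.le
    · exact hδ's Q hQ.1 (hQf.mono fun t => min_le_right _ _)
  refine Integrable.congr hφi ?_
  filter_upwards [hzero] with s hs
  exact (edist_eq_zero.1 hs).symm
lemma IntegrableOn.propSHK (hfr : ∀ p q : E, volume (frontier (Icc p q)) = 0) {a b : E}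
    {f : E → X} (hf : IntegrableOn f (Icc a b)) : PropSHK a b f := by
  intro ε hε
  obtain ⟨δ, hδ, hsum⟩ := exists_gauge_sum_setLIntegral_edist_le hfr hf
    (ε := ENNReal.ofReal (ε / 4)) (by simpa using hε)
  refine ⟨δ, hδ, fun P Q hP hPf hQ hQf => ?_⟩
  rw [← ENNReal.ofReal_lt_ofReal_iff hε, ofReal_sum_norm_sub_mul_volume,
    ← lintegral_edist_stepFun_stepFun hfr hP.1 hQ.1]
  have hmeas : AEMeasurable (fun s => edist (stepFun P f s) (f s)) (volume.restrict (Icc a b)) :=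
    (integrable_stepFun a b P f).aestronglyMeasurable.edist hf.aestronglyMeasurable
  calc ∫⁻ s in Icc a b, edist (stepFun P f s) (stepFun Q f s)
      ≤ ∫⁻ s in Icc a b, edist (stepFun P f s) (f s) + edist (stepFun Q f s) (f s) :=
        lintegral_mono fun s => edist_triangle_right _ _ _
    _ = (∑ x ∈ P, ∫⁻ s in itemBox x, edist (f x.1) (f s)) +
          ∑ y ∈ Q, ∫⁻ s in itemBox y, edist (f y.1) (f s) := by
        rw [lintegral_add_left' hmeas, sum_setLIntegral_edist_eq_stepFun hfr hP.1,
          sum_setLIntegral_edist_eq_stepFun hfr hQ.1]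
    _ ≤ ENNReal.ofReal (ε / 4) + ENNReal.ofReal (ε / 4) :=
        add_le_add (hsum P hP.1 hPf) (hsum Q hQ.1 hQf)
    _ = ENNReal.ofReal (ε / 2) := by
        rw [← ENNReal.ofReal_add (by positivity) (by positivity)]
        ring_nf
    _ < ENNReal.ofReal ε := (ENNReal.ofReal_lt_ofReal_iff hε).2 (by linarith)

variable [CompleteSpace X]

lemma exists_gauge_sum_norm_sub_setIntegral_lt
    (hfr : ∀ p q : E, volume (frontier (Icc p q)) = 0) {a b : E} {f : E → X}
    (hf : IntegrableOn f (Icc a b)) {ε : ℝ} (hε : 0 < ε) :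
    ∃ δ : E → ℝ, IsGauge (Icc a b) δ ∧ ∀ P : Finset (E × E × E), IsMPartition (Icc a b) P →
      IsFine δ P →
        ∑ x ∈ P, ‖(volume (itemBox x)).toReal • f x.1 - ∫ s in itemBox x, f s‖ < ε := by
  obtain ⟨δ, hδ, hsum⟩ := exists_gauge_sum_setLIntegral_edist_le hfr hf
    (ε := ENNReal.ofReal (ε / 2)) (by simpa using hε)
  refine ⟨δ, hδ, fun P hP hPf => ?_⟩
  suffices h : ∑ x ∈ P, ‖(volume (itemBox x)).toReal • f x.1 - ∫ s in itemBox x, f s‖ ≤ ε / 2 by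
    linarith
  rw [← ENNReal.ofReal_le_ofReal_iff (by positivity),
    ENNReal.ofReal_sum_of_nonneg fun x _ => norm_nonneg _]
  refine (Finset.sum_le_sum fun x hx => ?_).trans (hsum P hP hPf)
  have hfx : IntegrableOn f (itemBox x) := hf.mono_set (hP.itemBox_subset hx)
  have hconst : (volume (itemBox x)).toReal • f x.1 = ∫ _ in itemBox x, f x.1 :=
    (setIntegral_const _).symm
  have hci : Integrable (fun _ => f x.1) (volume.restrict (itemBox x)) :=
    integrableOn_const (volume_itemBox_ne_top x)
  rw [hconst, ← integral_sub hci hfx, ofReal_norm]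
  simp_rw [edist_eq_enorm_sub]
  exact enorm_integral_le_lintegral_enorm _

lemma IntegrableOn.hasStrongHKIntegral (hfr : ∀ p q : E, volume (frontier (Icc p q)) = 0)
    {a b : E} {f : E → X} (hf : IntegrableOn f (Icc a b)) :
    HasStrongHKIntegral a b f (∫ s in Icc a b, f s) := by
  refine ⟨fun x => ∫ s in Icc x.1 x.2, f s, ?_, rfl, fun ε hε => ?_⟩
  · intro p q r s u w hpq hrs _ hdisj hun
    simp only [← hun]
    exact setIntegral_union₀ (aedisjoint_Icc hfr hdisj) measurableSet_Icc.nullMeasurableSet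
      (hf.mono_set hpq.1) (hf.mono_set hrs.1)
  · obtain ⟨δ, hδ, h⟩ := exists_gauge_sum_norm_sub_setIntegral_lt hfr hf hε
    exact ⟨δ, hδ, fun P hP hPf => h P hP.1 hPf⟩

lemma HasHKIntegral.eq_setIntegral (hfr : ∀ p q : E, volume (frontier (Icc p q)) = 0) {a b : E}
    (hI : SubintervalInduction a b) {f : E → X} {v : X} (hv : HasHKIntegral (Icc a b) f v)
    (hf : IntegrableOn f (Icc a b)) : v = ∫ s in Icc a b, f s := by
  refine eq_of_forall_dist_le fun ε hε => ?_
  obtain ⟨δ, hδ, h⟩ := hv (ε / 2) (by positivity)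
  obtain ⟨δ', hδ', h'⟩ := exists_gauge_sum_norm_sub_setIntegral_lt hfr hf
    (ε := ε / 2) (by positivity)
  have hgauge : IsGauge (Icc a b) fun t => min (δ t) (δ' t) :=
    fun t ht => lt_min (hδ t ht) (hδ' t ht)
  obtain ⟨P, hP, hPf, -⟩ := exists_fine_partition hI hgauge ∅ one_pos (by simp)
  have h1 := h P hP (hPf.mono fun t => min_le_left _ _)
  have h2 := h' P hP.1 (hPf.mono fun t => min_le_right _ _)
  have hint : ∫ s in Icc a b, f s = ∑ x ∈ P, ∫ s in itemBox x, f s := by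
    have hun : ⋃ x : P, itemBox x.1 = Icc a b := by
      rw [← hP.1.2.2, iUnion_subtype]
    have hd : Pairwise (Function.onFun (AEDisjoint volume) fun x : P => itemBox x.1) :=
      fun x y hxy => aedisjoint_Icc hfr
        (hP.1.2.1 x x.2 y y.2 fun h => hxy (Subtype.ext h))
    rw [← hun, integral_iUnion_ae (fun x : P => (measurableSet_itemBox x.1).nullMeasurableSet) hd
      (hun ▸ hf), tsum_fintype, Finset.sum_coe_sort P fun x => ∫ s in itemBox x, f s]
  rw [hint]
  refine (dist_triangle_left _ _ (∑ x ∈ P, (volume (itemBox x)).toReal • f x.1)).trans ?_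
  rw [dist_eq_norm, dist_eq_norm, ← Finset.sum_sub_distrib]
  linarith [norm_sum_le P fun x =>
    (volume (itemBox x)).toReal • f x.1 - ∫ s in itemBox x, f s]

end Boxes

lemma volume_frontier_Icc_real (p q : ℝ) : volume (frontier (Icc p q)) = 0 :=
  (convex_Icc p q).addHaar_frontier volume

lemma volume_frontier_Icc_real_prod (p q : ℝ × ℝ) : volume (frontier (Icc p q)) = 0 := by
  rw [Icc_prod_eq]
  exact ((convex_Icc _ _).prod (convex_Icc _ _)).addHaar_frontier volume

/-- Theorem 2.2(ii): `g(t₁) = ∫_{[a₂,b₂]} (f₀)_{t₁}` is strongly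
integrable on `[a₁,b₁]` and its integral equals `∫_{[a,b]} f = v`. -/
theorem fubini_main_hk_fst {X : Type*} [NormedAddCommGroup X] [NormedSpace ℝ X] [CompleteSpace X] (a₁ b₁ a₂ b₂ : ℝ) (hab₁ : a₁ < b₁) (hab₂ : a₂ < b₂)
    (f : ℝ × ℝ → X) (v : X)
    (hfS : PropSHK ((a₁, a₂) : ℝ × ℝ) (b₁, b₂) f)
    (hf : HasHKIntegral (Set.Icc ((a₁, a₂) : ℝ × ℝ) (b₁, b₂)) f v)
    (Z₁ : Set ℝ) (hZ₁ : Z₁ = {t₁ : ℝ | t₁ ∈ Set.Icc a₁ b₁ ∧ ¬ PropSHK a₂ b₂ (fun s₂ => f (t₁, s₂))})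
    (Z₂ : Set ℝ) (hZ₂ : Z₂ = {t₂ : ℝ | t₂ ∈ Set.Icc a₂ b₂ ∧ ¬ PropSHK a₁ b₁ (fun s₁ => f (s₁, t₂))})
    (Z : Set (ℝ × ℝ)) (hZ : Z = (Z₁ ×ˢ Set.Icc a₂ b₂) ∪ ((Set.Icc a₁ b₁) ×ˢ Z₂))
    (f₀ : ℝ × ℝ → X) (hf₀ : f₀ = ((Set.Icc ((a₁, a₂) : ℝ × ℝ) (b₁, b₂)) \ Z).indicator f) :
    ∃ g : ℝ → X,
      (∀ t₁ ∈ Set.Icc a₁ b₁, HasStrongHKIntegral a₂ b₂ (fun s₂ => f₀ (t₁, s₂)) (g t₁)) ∧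
      HasStrongHKIntegral a₁ b₁ g v := by
  have hfi := hfS.integrableOn volume_frontier_Icc_real_prod
    (subintervalInduction_real_prod hab₁ hab₂)
  have hv := hf.eq_setIntegral volume_frontier_Icc_real_prod
    (subintervalInduction_real_prod hab₁ hab₂) hfi
  set μ₁ := (volume : Measure ℝ).restrict (Icc a₁ b₁) with hμ₁
  set μ₂ := (volume : Measure ℝ).restrict (Icc a₂ b₂) with hμ₂
  have hμ : (volume : Measure (ℝ × ℝ)).restrict (Icc (a₁, a₂) (b₁, b₂)) = μ₁.prod μ₂ := by
    rw [hμ₁, hμ₂, Measure.prod_restrict, Icc_prod_eq, Measure.volume_eq_prod]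
  have hfp : Integrable f (μ₁.prod μ₂) := hμ ▸ hfi
  have hsec₁ : ∀ᵐ t₁ ∂μ₁, t₁ ∉ Z₁ := by
    filter_upwards [hfp.prod_right_ae] with t₁ ht₁ hmem
    rw [hZ₁] at hmem
    exact hmem.2 (IntegrableOn.propSHK volume_frontier_Icc_real ht₁)
  have hsec₂ : ∀ᵐ t₂ ∂μ₂, t₂ ∉ Z₂ := by
    filter_upwards [hfp.prod_left_ae] with t₂ ht₂ hmem
    rw [hZ₂] at hmem
    exact hmem.2 (IntegrableOn.propSHK volume_frontier_Icc_real ht₂)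
  have hf₀_eq : ∀ t₁ ∈ Icc a₁ b₁, ∀ t₂ ∈ Icc a₂ b₂, t₁ ∉ Z₁ → t₂ ∉ Z₂ →
      f₀ (t₁, t₂) = f (t₁, t₂) := by
    intro t₁ ht₁ t₂ ht₂ hz₁ hz₂
    rw [hf₀, hZ]
    apply indicator_of_mem
    refine ⟨by rw [Icc_prod_eq]; exact ⟨ht₁, ht₂⟩, ?_⟩
    rintro (h | h)
    · exact hz₁ h.1
    · exact hz₂ h.2
  have hf₀_ae : f₀ =ᵐ[μ₁.prod μ₂] f := by
    have h₁ := Measure.quasiMeasurePreserving_fst (μ := μ₁) (ν := μ₂) |>.ae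
      (hsec₁.and (ae_restrict_mem measurableSet_Icc))
    have h₂ := Measure.quasiMeasurePreserving_snd (μ := μ₁) (ν := μ₂) |>.ae
      (hsec₂.and (ae_restrict_mem measurableSet_Icc))
    filter_upwards [h₁, h₂] with t ht₁ ht₂
    exact hf₀_eq t.1 ht₁.2 t.2 ht₂.2 ht₁.1 ht₂.1
  have hf₀i : Integrable f₀ (μ₁.prod μ₂) := hfp.congr hf₀_ae.symm
  have hsection : ∀ t₁ ∈ Icc a₁ b₁, IntegrableOn (fun s₂ => f₀ (t₁, s₂)) (Icc a₂ b₂) := by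
    intro t₁ ht₁
    by_cases hz : t₁ ∈ Z₁
    · refine integrableOn_zero.congr_fun (fun s₂ hs₂ => ?_) measurableSet_Icc
      rw [hf₀, hZ]
      exact (indicator_of_notMem (fun h => h.2 (Or.inl ⟨hz, hs₂⟩)) f).symm
    · have hprop : PropSHK a₂ b₂ fun s₂ => f (t₁, s₂) := by
        by_contra hnot
        exact hz (hZ₁ ▸ ⟨ht₁, hnot⟩)
      refine (hprop.integrableOn volume_frontier_Icc_real
        (subintervalInduction_real hab₂)).congr ?_
      filter_upwards [hsec₂, ae_restrict_mem measurableSet_Icc] with s₂ hs₂ hmem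
      exact (hf₀_eq t₁ ht₁ s₂ hmem hz hs₂).symm
  refine ⟨fun t₁ => ∫ s₂ in Icc a₂ b₂, f₀ (t₁, s₂), fun t₁ ht₁ =>
    IntegrableOn.hasStrongHKIntegral volume_frontier_Icc_real (hsection t₁ ht₁), ?_⟩
  have hvg : v = ∫ t₁ in Icc a₁ b₁, ∫ s₂ in Icc a₂ b₂, f₀ (t₁, s₂) := by
    rw [hv, hμ, ← integral_congr_ae hf₀_ae, integral_prod _ hf₀i]
  rw [hvg]
  exact IntegrableOn.hasStrongHKIntegral volume_frontier_Icc_real hf₀i.integral_prod_left
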